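/- Let φ and ϑ be inner functions on the open unit disc with ϑ(0) = 0. Then the composition ψ = ϑ ∘ φ is an inner function, and for every α ∈ T its Clark measures satisfy μ_α^ψ = ∫_T μ_β^φ dμ_α^ϑ(β), meaning that for every continuous function h on T, ∫_T h dμ_α^ψ = ∫_T (∫_T h dμ_β^φ) dμ_α^ϑ(β). -/

import Mathlib

open Complex MeasureTheory Metric Set Filter
open scoped Topology ComplexConjugate Real

/-- Normalized Lebesgue (Haar) measure on the unit circle, realized as a
measure on `ℂ`. -/
noncomputable def circleHaar : Measure ℂ :=
  (ENNReal.ofReal (2 * π)⁻¹) •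
    Measure.map (fun t : ℝ => Complex.exp (t * Complex.I))
      (volume.restrict (Ioc (0:ℝ) (2 * π)))

/-- An inner function: a bounded holomorphic self-map of the open unit disc
whose radial boundary values have modulus `1` Lebesgue-a.e. on the circle. -/
def IsInner (φ : ℂ → ℂ) : Prop :=
  DifferentiableOn ℂ φ (ball (0:ℂ) 1) ∧
  MapsTo φ (ball (0:ℂ) 1) (ball (0:ℂ) 1) ∧
  ∀ᵐ ω ∂circleHaar, Tendsto (fun r : ℝ => ‖φ (r • ω)‖) (𝓝[<] 1) (𝓝 1)

/-- `ν` is the Clark measure of `f` at `α ∈ 𝕋`: a finite positive Borel measure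
on the unit circle whose Poisson integral is `(1-|f(z)|²)/|α-f(z)|²`. -/
def IsClarkMeasure (f : ℂ → ℂ) (α : ℂ) (ν : Measure ℂ) : Prop :=
  IsFiniteMeasure ν ∧ ν (sphere (0:ℂ) 1)ᶜ = 0 ∧
    ∀ z ∈ ball (0:ℂ) 1,
      (∫ ζ, (1 - ‖z‖ ^ 2) / ‖ζ - z‖ ^ 2 ∂ν) = (1 - ‖f z‖ ^ 2) / ‖α - f z‖ ^ 2


/-- The Poisson kernel of the unit disc. -/
noncomputable def pk (z ζ : ℂ) : ℝ := (1 - ‖z‖ ^ 2) / ‖ζ - z‖ ^ 2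

lemma circleHaar_meas : Measurable (fun t : ℝ => Complex.exp (t * Complex.I)) := by fun_prop

instance circleHaar_prob : IsProbabilityMeasure circleHaar := by
  constructor
  have hpi := Real.pi_pos
  rw [circleHaar, Measure.smul_apply, Measure.map_apply circleHaar_meas MeasurableSet.univ]
  simp only [preimage_univ, Measure.restrict_apply_univ, Real.volume_Ioc, sub_zero, smul_eq_mul]
  rw [← ENNReal.ofReal_mul (by positivity)]
  rw [inv_mul_cancel₀ (by positivity)]; simp

lemma circleHaar_ae_iff {p : ℂ → Prop} (hp : MeasurableSet {x | p x}) :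
    (∀ᵐ ω ∂circleHaar, p ω) ↔
      ∀ᵐ t : ℝ ∂(volume.restrict (Ioc (0:ℝ) (2 * π))), p (Complex.exp (t * Complex.I)) := by
  have hpi := Real.pi_pos
  rw [circleHaar, Measure.ae_ennreal_smul_measure_iff (by simp [hpi]), ae_map_iff circleHaar_meas.aemeasurable hp]

lemma circleHaar_sphere : ∀ᵐ ω ∂circleHaar, ω ∈ sphere (0:ℂ) 1 := by
  rw [circleHaar_ae_iff]
  · refine ae_of_all _ fun t => ?_
    simp [Complex.norm_exp_ofReal_mul_I]
  · exact isClosed_sphere.measurableSet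

lemma restrict_sphere {ν : Measure ℂ} (hν : ν (sphere (0:ℂ) 1)ᶜ = 0) :
    ν.restrict (sphere (0:ℂ) 1) = ν :=
  Measure.restrict_eq_self_of_ae_mem (by rw [ae_iff]; exact hν)

lemma contOn_aesm {E : Type*} [NormedAddCommGroup E] {ν : Measure ℂ}
    (hν : ν (sphere (0:ℂ) 1)ᶜ = 0) {f : ℂ → E} (hf : ContinuousOn f (sphere (0:ℂ) 1)) :
    AEStronglyMeasurable f ν := by
  rw [← restrict_sphere hν]
  exact hf.aestronglyMeasurable_of_isCompact (isCompact_sphere _ _) isClosed_sphere.measurableSet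

lemma contOn_integrable {E : Type*} [NormedAddCommGroup E] {ν : Measure ℂ} [IsFiniteMeasure ν]
    (hν : ν (sphere (0:ℂ) 1)ᶜ = 0) {f : ℂ → E} (hf : ContinuousOn f (sphere (0:ℂ) 1)) :
    Integrable f ν := by
  rw [← restrict_sphere hν]
  exact hf.integrableOn_compact (isCompact_sphere _ _)

lemma circleHaar_compl : circleHaar (sphere (0:ℂ) 1)ᶜ = 0 := circleHaar_sphere

lemma integral_circleHaar {E : Type*} [NormedAddCommGroup E] [NormedSpace ℝ E]
    {f : ℂ → E} (hf : AEStronglyMeasurable f circleHaar) :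
    ∫ ω, f ω ∂circleHaar = Real.circleAverage f 0 1 := by
  have hpi := Real.pi_pos
  have hc : ENNReal.ofReal (2 * π)⁻¹ ≠ 0 := by simp [hpi]
  rw [circleHaar, integral_smul_measure, integral_map circleHaar_meas.aemeasurable,
    Real.circleAverage_def, intervalIntegral.integral_of_le (by positivity)]
  · rw [ENNReal.toReal_ofReal (by positivity)]
    simp [circleMap]
  · refine hf.mono_ac ?_
    rw [circleHaar]
    exact Measure.absolutelyContinuous_smul hc

lemma integral_circleHaar_cont {E : Type*} [NormedAddCommGroup E] [NormedSpace ℝ E]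
    {f : ℂ → E} (hf : ContinuousOn f (sphere (0:ℂ) 1)) :
    ∫ ω, f ω ∂circleHaar = Real.circleAverage f 0 1 :=
  integral_circleHaar (contOn_aesm circleHaar_compl hf)

lemma sub_norm_pos {z ζ : ℂ} (hz : z ∈ ball (0:ℂ) 1) (hζ : ζ ∈ sphere (0:ℂ) 1) : 0 < ‖ζ - z‖ := by
  rw [norm_pos_iff, sub_ne_zero]
  rintro rfl
  simp at hz hζ; linarith

lemma pk_cont {z : ℂ} (hz : z ∈ ball (0:ℂ) 1) : ContinuousOn (pk z) (sphere (0:ℂ) 1) := by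
  unfold pk
  refine ContinuousOn.div (by fun_prop) (by fun_prop) fun ζ hζ => ?_
  have := sub_norm_pos hz hζ
  positivity

lemma pk_nonneg {z : ℂ} (hz : z ∈ ball (0:ℂ) 1) (ζ : ℂ) : 0 ≤ pk z ζ := by
  unfold pk
  have : ‖z‖ < 1 := by simpa using hz
  have : 0 ≤ 1 - ‖z‖ ^ 2 := by nlinarith [norm_nonneg z]
  positivity

lemma integral_pk_smul {F : ℂ → ℂ} (hF : DiffContOnCl ℂ F (ball (0:ℂ) 1)) {z : ℂ}
    (hz : z ∈ ball (0:ℂ) 1) : ∫ ζ, pk z ζ • F ζ ∂circleHaar = F z := by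
  have hFc : ContinuousOn F (sphere (0:ℂ) 1) :=
    hF.continuousOn.mono (by rw [closure_ball _ one_ne_zero]; exact sphere_subset_closedBall)
  rw [integral_circleHaar_cont (f := fun ζ => pk z ζ • F ζ) ((pk_cont hz).smul hFc), ← hF.circleAverage_poissonKernel_smul' hz]
  refine Real.circleAverage_congr_sphere fun ζ hζ => ?_
  simp at hζ
  simp [pk, hζ]

lemma integral_pk {z : ℂ} (hz : z ∈ ball (0:ℂ) 1) : ∫ ζ, pk z ζ ∂circleHaar = 1 := by
  have := integral_pk_smul (F := fun _ => 1) diffContOnCl_const hz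
  simp only [real_smul, mul_one] at this
  rw [integral_complex_ofReal] at this
  exact_mod_cast this

lemma pk_integrable {z : ℂ} (hz : z ∈ ball (0:ℂ) 1) : Integrable (pk z) circleHaar :=
  contOn_integrable circleHaar_compl (pk_cont hz)

lemma smul_mem_ball {r : ℝ} (hr : r ∈ Ico (0:ℝ) 1) {ω : ℂ} (hω : ω ∈ closedBall (0:ℂ) 1) :
    r • ω ∈ ball (0:ℂ) 1 := by
  simp at hω ⊢
  rw [abs_of_nonneg hr.1]
  nlinarith [hr.1, hr.2, norm_nonneg ω]

/-- Poisson formula for bounded holomorphic functions with radial boundary values. -/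
lemma poisson_bdd {F : ℂ → ℂ} (hF : DifferentiableOn ℂ F (ball (0:ℂ) 1))
    {C : ℝ} (hb : ∀ z ∈ ball (0:ℂ) 1, ‖F z‖ ≤ C) {b : ℂ → ℂ}
    (hlim : ∀ᵐ ω ∂circleHaar, Tendsto (fun r : ℝ => F (r • ω)) (𝓝[<] 1) (𝓝 (b ω)))
    {z : ℂ} (hz : z ∈ ball (0:ℂ) 1) : ∫ ζ, pk z ζ • b ζ ∂circleHaar = F z := by
  have hev : ∀ᶠ r : ℝ in 𝓝[<] 1, r ∈ Ico (0:ℝ) 1 := Ico_mem_nhdsLT (by norm_num)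
  have hcl : ∀ r ∈ Ico (0:ℝ) 1, DiffContOnCl ℂ (fun w => F (r • w)) (ball (0:ℂ) 1) := by
    intro r hr
    refine DifferentiableOn.diffContOnCl ?_
    rw [closure_ball _ one_ne_zero]
    refine hF.comp (by fun_prop) fun w hw => smul_mem_ball hr hw
  have h1 : Tendsto (fun r : ℝ => ∫ ζ, pk z ζ • F (r • ζ) ∂circleHaar) (𝓝[<] 1)
      (𝓝 (∫ ζ, pk z ζ • b ζ ∂circleHaar)) := by
    refine tendsto_integral_filter_of_dominated_convergence (fun ζ => pk z ζ * C) ?_ ?_ ?_ ?_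
    · filter_upwards [hev] with r hr
      refine contOn_aesm circleHaar_compl ((pk_cont hz).smul ?_)
      refine (hcl r hr).continuousOn.mono ?_
      rw [closure_ball _ one_ne_zero]; exact sphere_subset_closedBall
    · filter_upwards [hev] with r hr
      filter_upwards [circleHaar_sphere] with ω hω
      rw [norm_smul, Real.norm_of_nonneg (pk_nonneg hz ω)]
      exact mul_le_mul_of_nonneg_left (hb _ (smul_mem_ball hr (sphere_subset_closedBall hω)))
        (pk_nonneg hz ω)
    · exact (pk_integrable hz).mul_const C
    · filter_upwards [hlim] with ω hω
      exact hω.const_smul _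
  have h2 : Tendsto (fun r : ℝ => ∫ ζ, pk z ζ • F (r • ζ) ∂circleHaar) (𝓝[<] 1) (𝓝 (F z)) := by
    have h3 : Tendsto (fun r : ℝ => F (r • z)) (𝓝[<] 1) (𝓝 (F z)) := by
      have hc : ContinuousAt F z := hF.continuousOn.continuousAt (isOpen_ball.mem_nhds hz)
      have : ContinuousAt (fun r : ℝ => F (r • z)) 1 := by
        refine ContinuousAt.comp (g := F) (by simpa using hc) (by fun_prop)
      have := this.tendsto.mono_left (nhdsWithin_le_nhds (s := Iio (1:ℝ)))
      simpa using this
    refine h3.congr' ?_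
    filter_upwards [hev] with r hr
    exact (integral_pk_smul (hcl r hr) hz).symm
  exact tendsto_nhds_unique h1 h2

lemma contOn_sphere {E : ℂ → ℂ} (hE : DiffContOnCl ℂ E (ball (0:ℂ) 1)) :
    ContinuousOn E (sphere (0:ℂ) 1) :=
  hE.continuousOn.mono (by rw [closure_ball _ one_ne_zero]; exact sphere_subset_closedBall)

lemma deriv_cauchy {E : ℂ → ℂ} (hE : DiffContOnCl ℂ E (ball (0:ℂ) 1)) {z : ℂ}
    (hz : z ∈ ball (0:ℂ) 1) :
    ∫ ζ, (ζ / (ζ - z) ^ 2) * E ζ ∂circleHaar = deriv E z := by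
  have hEc := contOn_sphere hE
  have hci : CircleIntegrable E 0 1 := hEc.circleIntegrable zero_le_one
  have h1 := hasDerivAt_circleAverage_herglotzRieszKernel_smul hci hz
  have h2 : ∀ w ∈ ball (0:ℂ) 1,
      Real.circleAverage (fun ζ ↦ herglotzRieszKernel 0 w ζ • E ζ) 0 1 = 2 * E w - E 0 := by
    intro w hw
    have hE' : DiffContOnCl ℂ E (ball (0:ℂ) |1|) := by simpa using hE
    have hw' : w ∈ ball (0:ℂ) |1| := by simpa using hw
    have a1 := hE'.circleAverage_smul_div hw'
    have a2 := hE'.circleAverage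
    have hne : ∀ ζ ∈ sphere (0:ℂ) 1, ζ - w ≠ 0 := fun ζ hζ => norm_pos_iff.1 (sub_norm_pos hw hζ)
    have i1 : ContinuousOn (fun ζ => ((ζ - 0) / (ζ - w)) • E ζ) (sphere (0:ℂ) 1) :=
      ContinuousOn.smul (ContinuousOn.div (by fun_prop) (by fun_prop) hne) hEc
    rw [← a1, ← a2, ← smul_eq_mul, ← Real.circleAverage_smul, ← Real.circleAverage_sub]
    · refine Real.circleAverage_congr_sphere fun ζ hζ => ?_
      have := hne ζ (by simpa using hζ)
      simp [herglotzRieszKernel]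
      field_simp
      ring
    · exact ((i1.const_smul (2:ℂ)).circleIntegrable zero_le_one)
    · exact hci
  have h3 : HasDerivAt (fun w ↦ Real.circleAverage (fun ζ ↦ herglotzRieszKernel 0 w ζ • E ζ) 0 1)
      (2 * deriv E z) z := by
    have : HasDerivAt (fun w => 2 * E w - E 0) (2 * deriv E z) z :=
      ((hE.differentiableAt isOpen_ball hz).hasDerivAt.const_mul 2).sub_const _
    refine this.congr_of_eventuallyEq ?_
    filter_upwards [isOpen_ball.mem_nhds hz] with w hw using h2 w hw
  have h4 := h1.unique h3
  have hne : ∀ ζ ∈ sphere (0:ℂ) 1, (ζ - z) ^ 2 ≠ 0 :=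
    fun ζ hζ => pow_ne_zero _ (norm_pos_iff.1 (sub_norm_pos hz hζ))
  rw [integral_circleHaar_cont (f := fun ζ => (ζ / (ζ - z) ^ 2) * E ζ)
    (ContinuousOn.mul (ContinuousOn.div (by fun_prop) (by fun_prop) hne) hEc)]
  have h5 : Real.circleAverage (fun ζ ↦ (2 * ζ / (ζ - z) ^ 2) • E ζ) 0 1 =
      2 * Real.circleAverage (fun ζ => (ζ / (ζ - z) ^ 2) * E ζ) 0 1 := by
    rw [← smul_eq_mul, ← Real.circleAverage_smul]
    refine Real.circleAverage_congr_sphere fun ζ hζ => ?_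
    simp; ring
  rw [h5] at h4
  exact mul_left_cancel₀ two_ne_zero h4

lemma cauchy_out {E : ℂ → ℂ} (hE : DiffContOnCl ℂ E (ball (0:ℂ) 1)) {w : ℂ}
    (hw : 1 < ‖w‖) :
    ∫ ζ, (ζ / (ζ - w) ^ 2) * E ζ ∂circleHaar = 0 := by
  have hne : ∀ ζ ∈ closedBall (0:ℂ) 1, (ζ - w) ^ 2 ≠ 0 := by
    intro ζ hζ
    refine pow_ne_zero _ (sub_ne_zero.2 ?_)
    rintro rfl
    simp at hζ; linarith
  have h1 : DiffContOnCl ℂ (fun ζ => (ζ / (ζ - w) ^ 2) * E ζ) (ball (0:ℂ) 1) := by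
    refine DiffContOnCl.smul (𝕜' := ℂ) (c := fun ζ => (ζ / (ζ - w) ^ 2)) ?_ hE
    refine DifferentiableOn.diffContOnCl ?_
    rw [closure_ball _ one_ne_zero]
    exact DifferentiableOn.div (by fun_prop) (by fun_prop) hne
  have h2 : DiffContOnCl ℂ (fun ζ => (ζ / (ζ - w) ^ 2) * E ζ) (ball (0:ℂ) |1|) := by
    simpa using h1
  rw [integral_circleHaar_cont (f := fun ζ => (ζ / (ζ - w) ^ 2) * E ζ) (contOn_sphere h1),
    h2.circleAverage]
  simp

/-- The key kernel estimate. -/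
lemma kernel_bound {r : ℝ} (hr : r ∈ Ioo (0:ℝ) 1) {ω ζ : ℂ} (hω : ω ∈ sphere (0:ℂ) 1)
    (hζ : ζ ∈ sphere (0:ℂ) 1) :
    ‖ζ / (ζ - r • ω) ^ 2 - ζ / (ζ - r⁻¹ • ω) ^ 2‖ * ‖ζ - ω‖ ≤ 4 * pk (r • ω) ζ ∧
    ‖ζ - ω‖ ≤ 2 * ‖ζ - r • ω‖ := by
  obtain ⟨hr0, hr1⟩ := hr
  have hz := smul_mem_ball (r := r) ⟨hr0.le, hr1⟩ (sphere_subset_closedBall hω)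
  have hp := sub_norm_pos hz hζ
  have hω1 : ‖ω‖ = 1 := by simpa using hω
  have hζ1 : ‖ζ‖ = 1 := by simpa using hζ
  have hzn : ‖r • ω‖ = r := by simp [hω1, abs_of_pos hr0]
  set d := ‖ζ - r • ω‖ with hd
  have e1 : ‖ζ - r⁻¹ • ω‖ = d / r := by
    have hsq : (r * ‖ζ - r⁻¹ • ω‖) ^ 2 = d ^ 2 := by
      have a1 : r * ‖ζ - r⁻¹ • ω‖ = ‖r • ζ - ω‖ := by
        rw [← abs_of_pos hr0, ← Real.norm_eq_abs, ← norm_smul, smul_sub, smul_smul,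
          Real.norm_eq_abs, abs_of_pos hr0, mul_inv_cancel₀ hr0.ne', one_smul]
      rw [a1, hd, ← normSq_eq_norm_sq, ← normSq_eq_norm_sq]
      have b1 : ω.re * ω.re + ω.im * ω.im = 1 := by
        rw [← normSq_apply, normSq_eq_norm_sq, hω1]; norm_num
      have b2 : ζ.re * ζ.re + ζ.im * ζ.im = 1 := by
        rw [← normSq_apply, normSq_eq_norm_sq, hζ1]; norm_num
      simp only [normSq_apply, sub_re, sub_im, smul_re, smul_im, smul_eq_mul]
      linear_combination (r^2 - 1) * b2 + (1 - r^2) * b1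
    have := (pow_left_inj₀ (by positivity) hp.le two_ne_zero).1 hsq
    rw [← this]; field_simp
  have e2 : 1 - r ≤ d := by
    have := norm_sub_norm_le ζ (r • ω)
    rwa [hζ1, hzn] at this
  have e3 : ‖ζ - ω‖ ≤ 2 * d := by
    have : ζ - ω = (ζ - r • ω) + (r - 1 : ℝ) • ω := by rw [sub_smul]; simp
    rw [this]
    refine (norm_add_le _ _).trans ?_
    rw [norm_smul, hω1, Real.norm_eq_abs, abs_of_nonpos (by linarith)]
    linarith
  refine ⟨?_, e3⟩
  have n1 : ζ - r • ω ≠ 0 := norm_pos_iff.1 hp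
  have n2 : ζ - r⁻¹ • ω ≠ 0 := norm_pos_iff.1 (by rw [e1]; positivity)
  have e4 : ζ / (ζ - r • ω) ^ 2 - ζ / (ζ - r⁻¹ • ω) ^ 2 =
      ζ * (((r - r⁻¹ : ℝ) • ω) * ((ζ - r • ω) + (ζ - r⁻¹ • ω))) /
        ((ζ - r • ω) ^ 2 * (ζ - r⁻¹ • ω) ^ 2) := by
    rw [div_sub_div _ _ (pow_ne_zero 2 n1) (pow_ne_zero 2 n2), sub_smul]
    congr 1
    ring
  have e5 : ‖(r - r⁻¹ : ℝ) • ω‖ = (1 - r ^ 2) / r := by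
    rw [norm_smul, hω1, mul_one, Real.norm_eq_abs, abs_of_nonpos]
    · field_simp; ring
    · have := one_lt_inv_iff₀.2 ⟨hr0, hr1⟩
      linarith
  have e6 : ‖(ζ - r • ω) + (ζ - r⁻¹ • ω)‖ ≤ d + d / r := by
    rw [← e1]; exact norm_add_le _ _
  have hr2 : 0 < 1 - r ^ 2 := by nlinarith
  have e7 : ‖ζ / (ζ - r • ω) ^ 2 - ζ / (ζ - r⁻¹ • ω) ^ 2‖ ≤ 2 * (1 - r ^ 2) / d ^ 3 := by
    rw [e4, norm_div, norm_mul, norm_mul, norm_mul, norm_pow, norm_pow, e5, e1, hζ1, one_mul, ← hd]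
    calc (1 - r ^ 2) / r * ‖(ζ - r • ω) + (ζ - r⁻¹ • ω)‖ / (d ^ 2 * (d / r) ^ 2)
        ≤ (1 - r ^ 2) / r * (d + d / r) / (d ^ 2 * (d / r) ^ 2) := by gcongr
      _ = (1 + r) * (1 - r ^ 2) / d ^ 3 := by field_simp; ring
      _ ≤ 2 * (1 - r ^ 2) / d ^ 3 := by gcongr; linarith
  calc _ ≤ 2 * (1 - r ^ 2) / d ^ 3 * (2 * d) := by gcongr
    _ = 4 * pk (r • ω) ζ := by
      rw [pk, hzn, ← hd]; field_simp; ring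

/-- Pointwise Fatou: differentiability of the boundary primitive gives a radial limit. -/
lemma fatou_point {g F : ℂ → ℂ} {L : NNReal} (hg : LipschitzWith L g)
    (hd : ∀ z ∈ ball (0:ℂ) 1, HasDerivAt g (F z) z) {ω c : ℂ} (hω : ω ∈ sphere (0:ℂ) 1)
    (hc : ∀ ε > 0, ∃ δ > 0, ∀ ζ ∈ sphere (0:ℂ) 1, ‖ζ - ω‖ < δ →
      ‖g ζ - g ω - c * (ζ - ω)‖ ≤ ε * ‖ζ - ω‖) :
    Tendsto (fun r : ℝ => F (r • ω)) (𝓝[<] 1) (𝓝 c) := by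
  have hω1 : ‖ω‖ = 1 := by simpa using hω
  set E : ℂ → ℂ := fun ζ => g ζ - g ω - c * (ζ - ω) with hEdef
  have hE : DiffContOnCl ℂ E (ball (0:ℂ) 1) := by
    refine ⟨fun z hz => ?_, ?_⟩
    · refine DifferentiableAt.differentiableWithinAt ?_
      have := (hd z hz).differentiableAt
      fun_prop
    · have := hg.continuous
      fun_prop
  have hEd : ∀ z ∈ ball (0:ℂ) 1, deriv E z = F z - c := by
    intro z hz
    have h1 : HasDerivAt E (F z - c * 1) z :=
      ((hd z hz).sub_const (g ω)).sub (((hasDerivAt_id z).sub_const ω).const_mul c)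
    simpa using h1.deriv
  set M : ℝ := L + ‖c‖ with hM
  have hM0 : 0 ≤ M := by positivity
  have hEM : ∀ ζ, ‖E ζ‖ ≤ M * ‖ζ - ω‖ := by
    intro ζ
    refine (norm_sub_le _ _).trans ?_
    rw [norm_mul, hM, add_mul]
    gcongr
    exact hg.norm_sub_le _ _
  have key : ∀ ε > 0, ∀ δ > 0, (∀ ζ ∈ sphere (0:ℂ) 1, ‖ζ - ω‖ < δ → ‖E ζ‖ ≤ ε * ‖ζ - ω‖) →
      ∀ r ∈ Ioo (0:ℝ) 1, ‖F (r • ω) - c‖ ≤ 4 * ε + 16 * M * (1 - r ^ 2) / δ ^ 2 := by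
    intro ε hε δ hδ h r hr
    have hz := smul_mem_ball (r := r) ⟨hr.1.le, hr.2⟩ (sphere_subset_closedBall hω)
    have hzn : ‖r • ω‖ = r := by simp [hω1, abs_of_pos hr.1]
    have hout : 1 < ‖r⁻¹ • ω‖ := by
      rw [norm_smul, hω1, mul_one, Real.norm_eq_abs, abs_of_pos (inv_pos.2 hr.1)]
      exact one_lt_inv_iff₀.2 hr
    have hEc := contOn_sphere hE
    have c1 : ContinuousOn (fun ζ => ζ / (ζ - r • ω) ^ 2 * E ζ) (sphere (0:ℂ) 1) :=
      ContinuousOn.mul (ContinuousOn.div (by fun_prop) (by fun_prop)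
        fun ζ hζ => pow_ne_zero _ (norm_pos_iff.1 (sub_norm_pos hz hζ))) hEc
    have c2 : ContinuousOn (fun ζ => ζ / (ζ - r⁻¹ • ω) ^ 2 * E ζ) (sphere (0:ℂ) 1) :=
      ContinuousOn.mul (ContinuousOn.div (by fun_prop) (by fun_prop)
        fun ζ hζ => pow_ne_zero _ (sub_ne_zero.2 (by
          rintro h
          have : ‖ζ‖ = 1 := by simpa using hζ
          rw [h] at this; linarith))) hEc
    have e1 : F (r • ω) - c = ∫ ζ, (ζ / (ζ - r • ω) ^ 2 * E ζ - ζ / (ζ - r⁻¹ • ω) ^ 2 * E ζ)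
        ∂circleHaar := by
      rw [integral_sub (contOn_integrable circleHaar_compl c1)
        (contOn_integrable circleHaar_compl c2), cauchy_out hE hout, deriv_cauchy hE hz,
        hEd _ hz, sub_zero]
    rw [e1]
    have hr2 : 0 < 1 - r ^ 2 := by nlinarith [hr.1, hr.2]
    have e2 : ∀ᵐ ζ ∂circleHaar, ‖ζ / (ζ - r • ω) ^ 2 * E ζ - ζ / (ζ - r⁻¹ • ω) ^ 2 * E ζ‖ ≤
        4 * ε * pk (r • ω) ζ + 16 * M * (1 - r ^ 2) / δ ^ 2 := by
      filter_upwards [circleHaar_sphere] with ζ hζ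
      obtain ⟨k1, k2⟩ := kernel_bound hr hω hζ
      rw [← sub_mul, norm_mul]
      have hpk := pk_nonneg hz ζ
      by_cases hlt : ‖ζ - ω‖ < δ
      · calc _ ≤ ‖ζ / (ζ - r • ω) ^ 2 - ζ / (ζ - r⁻¹ • ω) ^ 2‖ * (ε * ‖ζ - ω‖) := by
              gcongr; exact h ζ hζ hlt
          _ = ε * (‖ζ / (ζ - r • ω) ^ 2 - ζ / (ζ - r⁻¹ • ω) ^ 2‖ * ‖ζ - ω‖) := by ring
          _ ≤ ε * (4 * pk (r • ω) ζ) := by gcongr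
          _ ≤ _ := by
            have : 0 ≤ 16 * M * (1 - r ^ 2) / δ ^ 2 := by positivity
            linarith
      · push Not at hlt
        have hδ2 : δ / 2 ≤ ‖ζ - r • ω‖ := by linarith
        calc _ ≤ ‖ζ / (ζ - r • ω) ^ 2 - ζ / (ζ - r⁻¹ • ω) ^ 2‖ * (M * ‖ζ - ω‖) := by
              gcongr; exact hEM ζ
          _ = M * (‖ζ / (ζ - r • ω) ^ 2 - ζ / (ζ - r⁻¹ • ω) ^ 2‖ * ‖ζ - ω‖) := by ring
          _ ≤ M * (4 * pk (r • ω) ζ) := by gcongr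
          _ ≤ M * (4 * ((1 - r ^ 2) / (δ / 2) ^ 2)) := by
            rw [pk, hzn]; gcongr
          _ = 16 * M * (1 - r ^ 2) / δ ^ 2 := by field_simp; ring
          _ ≤ _ := by
            have : 0 ≤ 4 * ε * pk (r • ω) ζ := by positivity
            linarith
    refine (norm_integral_le_of_norm_le (((pk_integrable hz).const_mul _).add
      (integrable_const _)) e2).trans ?_
    simp only [Pi.add_apply]
    rw [integral_add ((pk_integrable hz).const_mul _) (integrable_const _), integral_const_mul,
      integral_pk hz]
    simp
  rw [Metric.tendsto_nhds]
  intro ε hε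
  obtain ⟨δ, hδ, h⟩ := hc (ε / 8) (by positivity)
  have h1 := key (ε / 8) (by positivity) δ hδ h
  have h2 : Tendsto (fun r : ℝ => 4 * (ε / 8) + 16 * M * (1 - r ^ 2) / δ ^ 2) (𝓝[<] 1)
      (𝓝 (4 * (ε / 8) + 16 * M * (1 - 1 ^ 2) / δ ^ 2)) := by
    refine Tendsto.mono_left ?_ nhdsWithin_le_nhds
    exact Continuous.tendsto (by fun_prop) 1
  have h3 := h2.eventually_lt_const (u := ε) (by norm_num; linarith)
  filter_upwards [h3, Ioo_mem_nhdsLT (show (0:ℝ) < 1 by norm_num)] with r hr hr'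
  rw [dist_eq_norm]
  exact (h1 r hr').trans_lt hr

/-- Fatou's theorem for bounded holomorphic functions. -/
lemma fatou {F : ℂ → ℂ} (hF : DifferentiableOn ℂ F (ball (0:ℂ) 1))
    (hb : ∀ z ∈ ball (0:ℂ) 1, ‖F z‖ ≤ 1) :
    ∀ᵐ ω ∂circleHaar, ∃ c, Tendsto (fun r : ℝ => F (r • ω)) (𝓝[<] 1) (𝓝 c) := by
  obtain ⟨g0, hg0⟩ := hF.isExactOn_ball
  have hlip0 : LipschitzOnWith 1 g0 (ball (0:ℂ) 1) :=
    (convex_ball (0:ℂ) 1).lipschitzOnWith_of_nnnorm_hasDerivWithin_le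
      (fun z hz => (hg0 z hz).hasDerivWithinAt) (fun z hz => by exact_mod_cast hb z hz)
  obtain ⟨g, hg, hgg⟩ := hlip0.extend_finite_dimension
  have hd : ∀ z ∈ ball (0:ℂ) 1, HasDerivAt g (F z) z := by
    intro z hz
    refine (hg0 z hz).congr_of_eventuallyEq ?_
    filter_upwards [isOpen_ball.mem_nhds hz] with w hw using (hgg hw).symm
  have hmeas : MeasurableSet {ω : ℂ | DifferentiableAt ℝ (fun s : ℝ => g (ω * exp (s * I))) 0} := by
    have h1 := measurableSet_of_differentiableAt_with_param ℝ
      (f := fun (ω : ℂ) (s : ℝ) => g (ω * exp (s * I)))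
      (by have := hg.continuous; simp only [Function.uncurry_def]; fun_prop)
    exact (measurable_id.prodMk (measurable_const (a := (0:ℝ)))) h1
  have hae : ∀ᵐ ω ∂circleHaar, DifferentiableAt ℝ (fun s : ℝ => g (ω * exp (s * I))) 0 := by
    rw [circleHaar_ae_iff hmeas]
    refine ae_restrict_of_ae ?_
    have hexp : LipschitzWith 1 (fun t : ℝ => exp (t * I)) := by
      refine lipschitzWith_of_nnnorm_deriv_le (𝕜 := ℝ) (by fun_prop) fun t => ?_
      have : HasDerivAt (fun t : ℝ => exp (t * I)) (exp (t * I) * (1 * I)) t :=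
        ((HasDerivAt.ofReal_comp (hasDerivAt_id t)).mul_const I).cexp
      rw [this.deriv]
      rw [← NNReal.coe_le_coe]
      simp [Complex.norm_exp_ofReal_mul_I]
    filter_upwards [(hg.comp hexp).ae_differentiableAt_real] with t ht
    have : (fun s : ℝ => g (exp (t * I) * exp (s * I))) =
        (g ∘ fun t : ℝ => exp (t * I)) ∘ (fun s : ℝ => t + s) := by
      ext s
      simp only [Function.comp_apply, ← Complex.exp_add]
      congr 2; push_cast; ring
    rw [this]
    refine DifferentiableAt.comp _ (by simpa using ht) (by fun_prop)
  filter_upwards [hae, circleHaar_sphere] with ω hω1 hω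
  have hωn : ‖ω‖ = 1 := by simpa using hω
  have hω0 : ω ≠ 0 := by rintro rfl; simp at hωn
  set d := deriv (fun s : ℝ => g (ω * exp (s * I))) 0
  refine ⟨d / (ω * I), fatou_point hg hd hω ?_⟩
  intro ε hε
  have hpi := Real.pi_pos
  have hderiv : HasDerivAt (fun s : ℝ => g (ω * exp (s * I)) - g ω
      - d / (ω * I) * (ω * exp (s * I) - ω)) 0 0 := by
    have h1 : HasDerivAt (fun s : ℝ => g (ω * exp (s * I))) d 0 := hω1.hasDerivAt
    have h2 : HasDerivAt (fun t : ℝ => exp (t * I)) (exp ((0:ℝ) * I) * (1 * I)) (0:ℝ) :=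
        ((HasDerivAt.ofReal_comp (hasDerivAt_id (0:ℝ))).mul_const I).cexp
    have h3 : HasDerivAt (fun s : ℝ => g (ω * exp (s * I)) - g ω
      - d / (ω * I) * (ω * exp (s * I) - ω)) (d - d / (ω * I) * (ω * (exp ((0:ℝ) * I) * (1 * I)))) 0 :=
      (h1.sub_const (g ω)).sub (((h2.const_mul ω).sub_const ω).const_mul (d / (ω * I)))
    convert h3 using 1
    simp
    field_simp
    simp
  have ho := hasDerivAt_iff_isLittleO.1 hderiv
  have ho' := ho.def (c := ε / (π / 2)) (by positivity)
  rw [Metric.eventually_nhds_iff] at ho'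
  obtain ⟨δ, hδ, hh⟩ := ho'
  refine ⟨δ / (π / 2), by positivity, fun ζ hζ hlt => ?_⟩
  have hζn : ‖ζ‖ = 1 := by simpa using hζ
  have hζ0 : ζ ≠ 0 := by rintro rfl; simp at hζn
  have hs : |(ζ / ω).arg| ≤ π / 2 * ‖ζ - ω‖ := by
    rw [← angle_eq_abs_arg hζ0 hω0]
    exact angle_le_mul_norm_sub hζn hωn
  have hexp : ω * exp ((ζ / ω).arg * I) = ζ := by
    have := norm_mul_exp_arg_mul_I (ζ / ω)
    rw [norm_div, hζn, hωn] at this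
    simp at this
    rw [this]; field_simp
  have := hh (y := (ζ / ω).arg) (by
    rw [Real.dist_eq, sub_zero]
    rw [lt_div_iff₀ (by positivity)] at hlt
    linarith)
  rw [hexp] at this
  simp at this
  calc _ ≤ ε / (π / 2) * |(ζ / ω).arg| := this
    _ ≤ ε / (π / 2) * (π / 2 * ‖ζ - ω‖) := by gcongr
    _ = ε * ‖ζ - ω‖ := by field_simp

/-- Poisson kernels have uniformly dense span in the continuous functions on the circle. -/
lemma pk_symm {r : ℝ} (hr : 0 ≤ r) {ω ζ : ℂ} (hω : ω ∈ sphere (0:ℂ) 1) (hζ : ζ ∈ sphere (0:ℂ) 1) :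
    pk (r • ω) ζ = pk (r • ζ) ω := by
  have hω1 : ‖ω‖ = 1 := by simpa using hω
  have hζ1 : ‖ζ‖ = 1 := by simpa using hζ
  have b1 : ω.re * ω.re + ω.im * ω.im = 1 := by
    rw [← normSq_apply, normSq_eq_norm_sq, hω1]; norm_num
  have b2 : ζ.re * ζ.re + ζ.im * ζ.im = 1 := by
    rw [← normSq_apply, normSq_eq_norm_sq, hζ1]; norm_num
  unfold pk
  rw [norm_smul, norm_smul, hω1, hζ1, ← normSq_eq_norm_sq (ζ - _), ← normSq_eq_norm_sq (ω - _)]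
  congr 1
  simp only [normSq_apply, sub_re, sub_im, smul_re, smul_im, smul_eq_mul]
  linear_combination (r^2 - 1) * b1 + (1 - r^2) * b2

lemma poisson_approx {h : ℂ → ℝ} (hh : Continuous h) {ε : ℝ} (hε : 0 < ε) :
    ∃ r ∈ Ioo (0:ℝ) 1, ∀ ζ ∈ sphere (0:ℂ) 1,
      |(∫ ω, h ω * pk (r • ω) ζ ∂circleHaar) - h ζ| ≤ ε := by
  have huc := (isCompact_sphere (0:ℂ) 1).uniformContinuousOn_of_continuous hh.continuousOn
  rw [Metric.uniformContinuousOn_iff] at huc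
  obtain ⟨δ, hδ, hu⟩ := huc (ε / 2) (by positivity)
  obtain ⟨H, hH⟩ := (isCompact_sphere (0:ℂ) 1).exists_bound_of_continuousOn hh.continuousOn
  have hH0 : 0 ≤ H := (norm_nonneg _).trans (hH 1 (by simp))
  have h2 : Tendsto (fun r : ℝ => ε / 2 + 8 * H * (1 - r ^ 2) / δ ^ 2) (𝓝[<] 1)
      (𝓝 (ε / 2 + 8 * H * (1 - 1 ^ 2) / δ ^ 2)) := by
    refine Tendsto.mono_left ?_ nhdsWithin_le_nhds
    exact Continuous.tendsto (by fun_prop) 1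
  have h3 := h2.eventually_lt_const (u := ε) (by norm_num; linarith)
  obtain ⟨r, hr, hr'⟩ := (h3.and (Ioo_mem_nhdsLT (show (0:ℝ) < 1 by norm_num))).exists
  refine ⟨r, hr', fun ζ hζ => le_trans ?_ hr.le⟩
  have hz := smul_mem_ball (r := r) ⟨hr'.1.le, hr'.2⟩ (sphere_subset_closedBall hζ)
  have hζ1 : ‖ζ‖ = 1 := by simpa using hζ
  have hzn : ‖r • ζ‖ = r := by simp [hζ1, abs_of_pos hr'.1]
  have hr2 : 0 < 1 - r ^ 2 := by nlinarith [hr'.1, hr'.2]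
  have e1 : ∫ ω, h ω * pk (r • ω) ζ ∂circleHaar = ∫ ω, h ω * pk (r • ζ) ω ∂circleHaar := by
    refine integral_congr_ae ?_
    filter_upwards [circleHaar_sphere] with ω hω
    rw [pk_symm hr'.1.le hω hζ]
  have e2 : h ζ = ∫ ω, h ζ * pk (r • ζ) ω ∂circleHaar := by
    rw [integral_const_mul, integral_pk hz, mul_one]
  rw [e1]
  rw [show |(∫ ω, h ω * pk (r • ζ) ω ∂circleHaar) - h ζ| = |(∫ ω, h ω * pk (r • ζ) ω ∂circleHaar)
    - ∫ ω, h ζ * pk (r • ζ) ω ∂circleHaar| by rw [← e2]]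
  rw [← integral_sub (contOn_integrable (f := fun ω => h ω * pk (r • ζ) ω) circleHaar_compl
    (hh.continuousOn.mul (pk_cont hz)))
    ((pk_integrable hz).const_mul _), ← Real.norm_eq_abs]
  have e3 : ∀ᵐ ω ∂circleHaar, ‖h ω * pk (r • ζ) ω - h ζ * pk (r • ζ) ω‖ ≤
      ε / 2 * pk (r • ζ) ω + 8 * H * (1 - r ^ 2) / δ ^ 2 := by
    filter_upwards [circleHaar_sphere] with ω hω
    have k2 := (kernel_bound hr' hζ hω).2
    have hpk := pk_nonneg hz ω
    rw [← sub_mul, norm_mul, Real.norm_of_nonneg hpk]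
    by_cases hlt : ‖ω - ζ‖ < δ
    · have := (hu ω hω ζ hζ (by rwa [dist_eq_norm])).le
      rw [dist_eq_norm] at this
      have h5 : 0 ≤ 8 * H * (1 - r ^ 2) / δ ^ 2 := by positivity
      nlinarith
    · push Not at hlt
      have hδ2 : δ / 2 ≤ ‖ω - r • ζ‖ := by linarith
      calc _ ≤ (2 * H) * pk (r • ζ) ω := by
            gcongr
            refine (norm_sub_le _ _).trans ?_
            linarith [hH ω hω, hH ζ hζ]
        _ ≤ (2 * H) * ((1 - r ^ 2) / (δ / 2) ^ 2) := by rw [pk, hzn]; gcongr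
        _ = 8 * H * (1 - r ^ 2) / δ ^ 2 := by field_simp; ring
        _ ≤ _ := by
          have : 0 ≤ ε / 2 * pk (r • ζ) ω := by positivity
          linarith
  refine (norm_integral_le_of_norm_le (((pk_integrable hz).const_mul _).add
      (integrable_const _)) e3).trans ?_
  simp only [Pi.add_apply]
  rw [integral_add ((pk_integrable hz).const_mul _) (integrable_const _), integral_const_mul,
      integral_pk hz]
  simp

/-- The span of the Poisson kernels. -/
noncomputable def pkSpan : Submodule ℝ (ℂ → ℝ) := Submodule.span ℝ (pk '' ball (0:ℂ) 1)

lemma pk_dense {h : ℂ → ℝ} (hh : Continuous h) {ε : ℝ} (hε : 0 < ε) :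
    ∃ g ∈ pkSpan, ∀ ζ ∈ sphere (0:ℂ) 1, |h ζ - g ζ| ≤ ε := by
  obtain ⟨r, hr, happ⟩ := poisson_approx hh (half_pos hε)
  obtain ⟨τ, hτ⟩ : ∃ τ : Measure ℝ, τ = ENNReal.ofReal (2 * π)⁻¹ • volume.restrict (Ioc (0:ℝ) (2 * π)) :=
    ⟨_, rfl⟩
  have hmap : circleHaar = Measure.map (fun t : ℝ => exp (t * I)) τ := by
    rw [circleHaar, hτ, Measure.map_smul]
  have : IsProbabilityMeasure τ := by
    have : IsProbabilityMeasure (Measure.map (fun t : ℝ => exp (t * I)) τ) := by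
      rw [← hmap]; infer_instance
    exact Measure.isProbabilityMeasure_of_map (fun t : ℝ => exp (t * I))
  have hsph : ∀ t : ℝ, exp (t * I) ∈ sphere (0:ℂ) 1 := by
    intro t; simp [Complex.norm_exp_ofReal_mul_I]
  have hball : ∀ t : ℝ, r • exp (t * I) ∈ ball (0:ℂ) 1 := fun t =>
    smul_mem_ball ⟨hr.1.le, hr.2⟩ (sphere_subset_closedBall (hsph t))
  have hjc : Continuous (fun p : ℝ × sphere (0:ℂ) 1 => pk (r • exp (p.1 * I)) p.2) := by
    unfold pk
    refine Continuous.div (by fun_prop) (by fun_prop) fun p => ?_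
    have := sub_norm_pos (hball p.1) p.2.2
    positivity
  obtain ⟨Q, hQ, hQv⟩ : ∃ Q : ℝ → C(sphere (0:ℂ) 1, ℝ), Continuous Q ∧
      ∀ t ζ, Q t ζ = pk (r • exp (t * I)) ζ := by
    let J : C(ℝ × sphere (0:ℂ) 1, ℝ) := ⟨_, hjc⟩
    exact ⟨fun t => J.curry t, J.curry.continuous, fun t ζ => ContinuousMap.curry_apply J t ζ⟩
  let S0 : Submodule ℝ C(sphere (0:ℂ) 1, ℝ) := Submodule.span ℝ (range Q)
  have hfc : Continuous (fun t : ℝ => h (exp (t * I)) • Q t) := by fun_prop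
  have hIntg : Integrable (fun t : ℝ => h (exp (t * I)) • Q t) τ := by
    rw [hτ]
    have h0 : Integrable (fun t : ℝ => h (exp (t * I)) • Q t)
      (volume.restrict (Ioc (0:ℝ) (2 * π))) := hfc.integrableOn_Ioc
    exact Integrable.smul_measure (ε := C(sphere (0:ℂ) 1, ℝ)) h0 ENNReal.ofReal_ne_top
  have hmem : (∫ t, h (exp (t * I)) • Q t ∂τ) ∈ S0.topologicalClosure := by
    have := (S0.topologicalClosure.convex).integral_mem (μ := τ) (f := fun t : ℝ => h (exp (t * I)) • Q t)
      S0.isClosed_topologicalClosure (ae_of_all _ fun t => S0.topologicalClosure.smul_mem _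
        (S0.le_topologicalClosure (Submodule.subset_span ⟨t, rfl⟩))) hIntg
    exact this
  have hval : ∀ ζ : sphere (0:ℂ) 1, (∫ t, h (exp (t * I)) • Q t ∂τ) ζ =
      ∫ ω, h ω * pk (r • ω) ζ ∂circleHaar := by
    intro ζ
    have h1 := (ContinuousMap.evalCLM ℝ ζ).integral_comp_comm hIntg
    have h2 : (∫ t, h (exp (t * I)) • Q t ∂τ) ζ =
        ContinuousMap.evalCLM ℝ ζ (∫ t, h (exp (t * I)) • Q t ∂τ) := rfl
    rw [h2, ← h1, hmap, integral_map circleHaar_meas.aemeasurable]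
    · refine integral_congr_ae (ae_of_all _ fun t => ?_)
      simp [hQv]
    · rw [← hmap]
      refine contOn_aesm circleHaar_compl (hh.continuousOn.mul ?_)
      refine (pk_cont (smul_mem_ball ⟨hr.1.le, hr.2⟩ (sphere_subset_closedBall ζ.2))).congr ?_
      intro ω hω
      exact pk_symm hr.1.le hω ζ.2
  rw [← SetLike.mem_coe, Submodule.topologicalClosure_coe, Metric.mem_closure_iff] at hmem
  obtain ⟨b, hb, hdist⟩ := hmem (ε / 2) (half_pos hε)
  have hb' : ∃ g ∈ pkSpan, ∀ ζ : sphere (0:ℂ) 1, b ζ = g ζ := by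
    refine Submodule.span_induction (p := fun b _ => ∃ g ∈ pkSpan, ∀ ζ : sphere (0:ℂ) 1, b ζ = g ζ)
      ?_ ?_ ?_ ?_ hb
    · rintro _ ⟨t, rfl⟩
      exact ⟨pk (r • exp (t * I)), Submodule.subset_span ⟨_, hball t, rfl⟩, fun ζ => hQv t ζ⟩
    · exact ⟨0, zero_mem _, fun ζ => rfl⟩
    · rintro x y _ _ ⟨g1, hg1, e1⟩ ⟨g2, hg2, e2⟩
      exact ⟨g1 + g2, add_mem hg1 hg2, fun ζ => by simp [e1, e2]⟩
    · rintro a x _ ⟨g1, hg1, e1⟩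
      exact ⟨a • g1, Submodule.smul_mem _ _ hg1, fun ζ => by simp [e1]⟩
  obtain ⟨g, hg, hbg⟩ := hb'
  refine ⟨g, hg, fun ζ hζ => ?_⟩
  have h1 := happ ζ hζ
  have h2 := (ContinuousMap.dist_apply_le_dist (f := ∫ t, h (exp (t * I)) • Q t ∂τ) (g := b)
    ⟨ζ, hζ⟩).trans hdist.le
  rw [hval, hbg, Real.dist_eq] at h2
  rw [abs_sub_comm] at h1
  refine (abs_sub_le _ _ _).trans (by linarith : _ ≤ ε)

lemma pkSpan_cont {g : ℂ → ℝ} (hg : g ∈ pkSpan) : ContinuousOn g (sphere (0:ℂ) 1) := by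
  refine Submodule.span_induction (p := fun g _ => ContinuousOn g (sphere (0:ℂ) 1)) ?_ ?_ ?_ ?_ hg
  · rintro _ ⟨z, hz, rfl⟩
    exact pk_cont hz
  · exact continuousOn_const
  · intro x y _ _ hx hy
    exact hx.add hy
  · intro a x _ hx
    exact hx.const_smul a

lemma ae_sphere {ν : Measure ℂ} (hν : ν (sphere (0:ℂ) 1)ᶜ = 0) :
    ∀ᵐ ζ ∂ν, ζ ∈ sphere (0:ℂ) 1 := hν

lemma integral_approx {ν : Measure ℂ} [IsFiniteMeasure ν] (hν : ν (sphere (0:ℂ) 1)ᶜ = 0)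
    {f g : ℂ → ℝ} (hf : ContinuousOn f (sphere (0:ℂ) 1)) (hg : ContinuousOn g (sphere (0:ℂ) 1))
    {ε : ℝ} (h : ∀ ζ ∈ sphere (0:ℂ) 1, |f ζ - g ζ| ≤ ε) :
    |(∫ ζ, f ζ ∂ν) - ∫ ζ, g ζ ∂ν| ≤ ε * ν.real univ := by
  rw [← integral_sub (contOn_integrable hν hf) (contOn_integrable hν hg), ← Real.norm_eq_abs]
  refine norm_integral_le_of_norm_le_const ?_
  filter_upwards [ae_sphere hν] with ζ hζ using h ζ hζ

lemma eq_of_forall_eps {a C : ℝ} (h : ∀ ε > 0, a ≤ ε * C) : a ≤ 0 := by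
  by_contra! ha
  have hC : 0 < C := by have := h 1 one_pos; linarith
  have := h (a / (2 * C)) (by positivity)
  have e : a / (2 * C) * C = a / 2 := by field_simp
  linarith

lemma measure_eq {ν ν' : Measure ℂ} [IsFiniteMeasure ν] [IsFiniteMeasure ν']
    (hν : ν (sphere (0:ℂ) 1)ᶜ = 0) (hν' : ν' (sphere (0:ℂ) 1)ᶜ = 0)
    (h : ∀ z ∈ ball (0:ℂ) 1, ∫ ζ, pk z ζ ∂ν = ∫ ζ, pk z ζ ∂ν') : ν = ν' := by
  refine ext_of_forall_integral_eq_of_IsFiniteMeasure fun f => ?_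
  have hs : ∀ g ∈ pkSpan, ∫ ζ, g ζ ∂ν = ∫ ζ, g ζ ∂ν' := by
    intro g hg
    refine Submodule.span_induction (p := fun g _ => ∫ ζ, g ζ ∂ν = ∫ ζ, g ζ ∂ν') ?_ ?_ ?_ ?_ hg
    · rintro _ ⟨z, hz, rfl⟩
      exact h z hz
    · simp
    · intro x y hx hy ex ey
      simp only [Pi.add_apply]
      rw [integral_add (contOn_integrable hν (pkSpan_cont hx))
        (contOn_integrable hν (pkSpan_cont hy)), integral_add
        (contOn_integrable hν' (pkSpan_cont hx)) (contOn_integrable hν' (pkSpan_cont hy)), ex, ey]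
    · intro a x hx ex
      simp only [Pi.smul_apply]
      rw [integral_smul, integral_smul, ex]
  rw [← sub_eq_zero, ← abs_nonpos_iff]
  refine eq_of_forall_eps (C := ν.real univ + ν'.real univ) fun ε hε => ?_
  obtain ⟨g, hg, hfg⟩ := pk_dense f.continuous hε
  have h1 := integral_approx hν f.continuous.continuousOn (pkSpan_cont hg) hfg
  have h2 := integral_approx hν' f.continuous.continuousOn (pkSpan_cont hg) hfg
  rw [hs g hg] at h1
  rw [abs_sub_comm] at h2
  have h3 := abs_sub_le (∫ ζ, f ζ ∂ν) (∫ ζ, g ζ ∂ν') (∫ ζ, f ζ ∂ν')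
  linarith

lemma pk_unique_zero {f : ℂ → ℂ} (hf : Integrable f circleHaar)
    (h : ∀ z ∈ ball (0:ℂ) 1, ∫ ζ, pk z ζ • f ζ ∂circleHaar = 0) :
    ∀ᵐ ζ ∂circleHaar, f ζ = 0 := by
  have hIntg : ∀ g : ℂ → ℝ, ContinuousOn g (sphere (0:ℂ) 1) →
      Integrable (fun ζ => g ζ • f ζ) circleHaar := by
    intro g hg
    obtain ⟨C, hC⟩ := (isCompact_sphere (0:ℂ) 1).exists_bound_of_continuousOn hg
    refine hf.bdd_smul C (contOn_aesm circleHaar_compl hg) ?_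
    filter_upwards [circleHaar_sphere] with ζ hζ using hC ζ hζ
  have hs : ∀ g ∈ pkSpan, ∫ ζ, g ζ • f ζ ∂circleHaar = 0 := by
    intro g hg
    refine Submodule.span_induction (p := fun g _ => ∫ ζ, g ζ • f ζ ∂circleHaar = 0) ?_ ?_ ?_ ?_ hg
    · rintro _ ⟨z, hz, rfl⟩
      exact h z hz
    · simp
    · intro x y hx hy ex ey
      simp only [Pi.add_apply, add_smul]
      rw [integral_add (hIntg _ (pkSpan_cont hx)) (hIntg _ (pkSpan_cont hy)), ex, ey, add_zero]
    · intro a x hx ex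
      simp only [Pi.smul_apply, smul_assoc]
      rw [integral_smul, ex, smul_zero]
  refine ae_eq_zero_of_integral_contDiff_smul_eq_zero hf.locallyIntegrable fun k hk _ => ?_
  rw [← norm_le_zero_iff]
  refine eq_of_forall_eps (C := ∫ ζ, ‖f ζ‖ ∂circleHaar) fun ε hε => ?_
  obtain ⟨g, hg, hfg⟩ := pk_dense hk.continuous hε
  have e1 : ∫ ζ, k ζ • f ζ ∂circleHaar = ∫ ζ, (k ζ • f ζ - g ζ • f ζ) ∂circleHaar := by
    rw [integral_sub (hIntg _ hk.continuous.continuousOn) (hIntg _ (pkSpan_cont hg)), hs g hg,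
      sub_zero]
  rw [e1, ← integral_const_mul]
  refine norm_integral_le_of_norm_le (hf.norm.const_mul ε) ?_
  filter_upwards [circleHaar_sphere] with ζ hζ
  rw [← sub_smul, norm_smul]
  gcongr
  exact hfg ζ hζ

lemma radial_contOn {F : ℂ → ℂ} (hF : DifferentiableOn ℂ F (ball (0:ℂ) 1)) {r : ℝ}
    (hr : r ∈ Ico (0:ℝ) 1) : ContinuousOn (fun ω : ℂ => F (r • ω)) (closedBall (0:ℂ) 1) :=
  hF.continuousOn.comp (by fun_prop) fun _ hw => smul_mem_ball hr hw

lemma exists_boundary {F : ℂ → ℂ} (hF : DifferentiableOn ℂ F (ball (0:ℂ) 1))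
    (hb : ∀ z ∈ ball (0:ℂ) 1, ‖F z‖ ≤ 1) :
    ∃ b : ℂ → ℂ, Measurable b ∧
      (∀ᵐ ω ∂circleHaar, Tendsto (fun r : ℝ => F (r • ω)) (𝓝[<] 1) (𝓝 (b ω))) ∧
      ∀ᵐ ω ∂circleHaar, ‖b ω‖ ≤ 1 := by
  obtain ⟨u, hu1, hu2, hu3⟩ := exists_seq_strictMono_tendsto' (show (0:ℝ) < 1 by norm_num)
  have hu : Tendsto u atTop (𝓝[<] 1) :=
    tendsto_nhdsWithin_iff.2 ⟨hu3, Eventually.of_forall fun n => (hu2 n).2⟩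
  have hF1 := fatou hF hb
  obtain ⟨b, hbm, hbl⟩ := exists_stronglyMeasurable_limit_of_tendsto_ae (μ := circleHaar)
    (f := fun n ω => F (u n • ω))
    (fun n => contOn_aesm circleHaar_compl
      ((radial_contOn hF ⟨(hu2 n).1.le, (hu2 n).2⟩).mono sphere_subset_closedBall))
    (by filter_upwards [hF1] with ω ⟨c, hc⟩ using ⟨c, hc.comp hu⟩)
  refine ⟨b, hbm.measurable, ?_, ?_⟩
  · filter_upwards [hF1, hbl] with ω ⟨c, hc⟩ hω
    rwa [tendsto_nhds_unique hω (hc.comp hu)]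
  · filter_upwards [hbl, circleHaar_sphere] with ω hω hs
    refine le_of_tendsto hω.norm (Eventually.of_forall fun n => hb _ ?_)
    exact smul_mem_ball ⟨(hu2 n).1.le, (hu2 n).2⟩ (sphere_subset_closedBall hs)

lemma inner_boundary {F : ℂ → ℂ} (hF : IsInner F) :
    ∃ b : ℂ → ℂ, Measurable b ∧
      (∀ᵐ ω ∂circleHaar, Tendsto (fun r : ℝ => F (r • ω)) (𝓝[<] 1) (𝓝 (b ω))) ∧
      ∀ᵐ ω ∂circleHaar, ‖b ω‖ = 1 := by
  obtain ⟨b, hm, hl, -⟩ := exists_boundary hF.1 fun z hz => by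
    have := hF.2.1 hz; simp at this; exact this.le
  refine ⟨b, hm, hl, ?_⟩
  filter_upwards [hl, hF.2.2] with ω h1 h2
  exact tendsto_nhds_unique h1.norm h2

lemma pk_measurable (w : ℂ) : Measurable (pk w) := by unfold pk; fun_prop

lemma pk_eq_re {w ζ : ℂ} (hw : w ∈ ball (0:ℂ) 1) (hζ : ζ ∈ sphere (0:ℂ) 1) :
    ((1 + conj w * ζ) / (1 - conj w * ζ)).re = pk w ζ := by
  have hζ1 : ‖ζ‖ = 1 := by simpa using hζ
  have b2 : ζ.re * ζ.re + ζ.im * ζ.im = 1 := by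
    rw [← normSq_apply, normSq_eq_norm_sq, hζ1]; norm_num
  have e : normSq (1 - conj w * ζ) = normSq (ζ - w) := by
    simp [normSq_apply]
    linear_combination (w.re^2 + w.im^2 - 1) * b2
  rw [div_re, pk, ← normSq_eq_norm_sq, ← normSq_eq_norm_sq, e, ← add_div]
  congr 1
  simp [normSq_apply]
  linear_combination -(w.re^2 + w.im^2) * b2

lemma push_ac {φ : ℂ → ℂ} (hφ : IsInner φ) {b : ℂ → ℂ} (hbm : Measurable b)
    (hbl : ∀ᵐ ω ∂circleHaar, Tendsto (fun r : ℝ => φ (r • ω)) (𝓝[<] 1) (𝓝 (b ω)))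
    (hb1 : ∀ᵐ ω ∂circleHaar, ‖b ω‖ = 1) : Measure.map b circleHaar ≪ circleHaar := by
  have h0 : (0:ℂ) ∈ ball (0:ℂ) 1 := by simp
  have ha : φ 0 ∈ ball (0:ℂ) 1 := hφ.2.1 h0
  have hfin : IsFiniteMeasure (circleHaar.withDensity fun ζ => ENNReal.ofReal (pk (φ 0) ζ)) :=
    isFiniteMeasure_withDensity_ofReal (pk_integrable ha).2
  have hac : (circleHaar.withDensity fun ζ => ENNReal.ofReal (pk (φ 0) ζ)) ≪ circleHaar :=
    withDensity_absolutelyContinuous _ _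
  have : IsProbabilityMeasure (Measure.map b circleHaar) :=
    Measure.isProbabilityMeasure_map hbm.aemeasurable
  have heq : Measure.map b circleHaar =
      circleHaar.withDensity fun ζ => ENNReal.ofReal (pk (φ 0) ζ) := by
    refine measure_eq ?_ (hac circleHaar_compl) fun w hw => ?_
    · rw [Measure.map_apply hbm isClosed_sphere.measurableSet.compl]
      change ∀ᵐ ω ∂circleHaar, b ω ∈ sphere (0:ℂ) 1
      filter_upwards [hb1] with ω hω
      simpa using hω
    · set H : ℂ → ℂ := fun ζ => (1 + conj w * ζ) / (1 - conj w * ζ) with hH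
      have hw1 : ‖w‖ < 1 := by simpa using hw
      have hne : ∀ ζ ∈ closedBall (0:ℂ) 1, 1 - conj w * ζ ≠ 0 := by
        intro ζ hζ h
        have h1 : ‖conj w * ζ‖ = 1 := by rw [← sub_eq_zero.1 h]; simp
        have hζ1 : ‖ζ‖ ≤ 1 := by simpa using hζ
        rw [norm_mul, RCLike.norm_conj] at h1
        nlinarith [norm_nonneg w, norm_nonneg ζ]
      have hHd : DifferentiableOn ℂ H (closedBall (0:ℂ) 1) :=
        DifferentiableOn.div (by fun_prop) (by fun_prop) hne
      obtain ⟨C, hC⟩ := (isCompact_closedBall (0:ℂ) 1).exists_bound_of_continuousOn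
        hHd.continuousOn
      have hHc : DiffContOnCl ℂ H (ball (0:ℂ) 1) := by
        refine DifferentiableOn.diffContOnCl ?_
        rwa [closure_ball _ one_ne_zero]
      have hHm : Measurable H := by rw [hH]; fun_prop
      -- left side
      have e1 : ∫ ζ, pk 0 ζ • H (b ζ) ∂circleHaar = H (φ 0) := by
        refine poisson_bdd (F := fun z => H (φ z)) (C := C) ?_ ?_ ?_ h0
        · exact (hHd.mono ball_subset_closedBall).comp hφ.1 hφ.2.1
        · exact fun z hz => hC _ (ball_subset_closedBall (hφ.2.1 hz))
        · filter_upwards [hbl, hb1, circleHaar_sphere] with ω hω hω1 hs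
          have hcw := hHd.continuousOn (b ω) (by simp [hω1])
          refine hcw.tendsto.comp (tendsto_nhdsWithin_iff.2 ⟨hω, ?_⟩)
          filter_upwards [Ico_mem_nhdsLT (show (0:ℝ) < 1 by norm_num)] with r hr
          exact ball_subset_closedBall (hφ.2.1 (smul_mem_ball hr (sphere_subset_closedBall hs)))
      have i1 : Integrable (fun ζ => H (b ζ)) circleHaar := by
        refine Integrable.of_bound (hHm.comp hbm).aestronglyMeasurable C ?_
        filter_upwards [hb1] with ω hω using hC _ (by simp [hω])
      have e2 : ∫ ζ, pk w ζ ∂(Measure.map b circleHaar) = (H (φ 0)).re := by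
        rw [integral_map hbm.aemeasurable (pk_measurable w).aestronglyMeasurable, ← e1]
        have : ∫ ζ, pk 0 ζ • H (b ζ) ∂circleHaar = ∫ ζ, H (b ζ) ∂circleHaar := by
          refine integral_congr_ae ?_
          filter_upwards [circleHaar_sphere] with ω hω
          have : ‖ω‖ = 1 := by simpa using hω
          simp [pk, this]
        rw [this]
        have h3 := reCLM.integral_comp_comm i1
        simp only [reCLM_apply] at h3
        rw [← h3]
        refine integral_congr_ae ?_
        filter_upwards [hb1] with ω hω
        exact (pk_eq_re hw (by simpa using hω)).symm
      have i2 : Integrable (fun ζ => pk (φ 0) ζ • H ζ) circleHaar :=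
        contOn_integrable circleHaar_compl ((pk_cont ha).smul (contOn_sphere hHc))
      have e3 : ∫ ζ, pk w ζ ∂(circleHaar.withDensity fun ζ => ENNReal.ofReal (pk (φ 0) ζ)) =
          (H (φ 0)).re := by
        rw [integral_withDensity_eq_integral_toReal_smul (by have := pk_measurable (φ 0); fun_prop)
          (ae_of_all _ fun _ => ENNReal.ofReal_lt_top), ← integral_pk_smul hHc ha]
        have h3 := reCLM.integral_comp_comm i2
        simp only [reCLM_apply] at h3
        rw [← h3]
        refine integral_congr_ae ?_
        filter_upwards [circleHaar_sphere] with ω hω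
        rw [ENNReal.toReal_ofReal (pk_nonneg ha ω), smul_re, ← pk_eq_re hw hω]
      rw [e2, e3]
  rw [heq]
  exact hac

lemma inner_comp {φ ϑ : ℂ → ℂ} (hφ : IsInner φ) (hϑ : IsInner ϑ) :
    IsInner (fun z => ϑ (φ z)) := by
  have hd : DifferentiableOn ℂ (fun z => ϑ (φ z)) (ball (0:ℂ) 1) := hϑ.1.comp hφ.1 hφ.2.1
  have hmap : MapsTo (fun z => ϑ (φ z)) (ball (0:ℂ) 1) (ball (0:ℂ) 1) :=
    fun z hz => hϑ.2.1 (hφ.2.1 hz)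
  refine ⟨hd, hmap, ?_⟩
  have hbd : ∀ {F : ℂ → ℂ}, MapsTo F (ball (0:ℂ) 1) (ball (0:ℂ) 1) →
      ∀ z ∈ ball (0:ℂ) 1, ‖F z‖ ≤ 1 := by
    intro F hF z hz
    have := hF hz; simp at this; exact this.le
  obtain ⟨b, hbm, hbl, hb1⟩ := inner_boundary hφ
  obtain ⟨t, htm, htl, ht1⟩ := inner_boundary hϑ
  obtain ⟨p, hpm, hpl, hp1⟩ := exists_boundary hd (hbd hmap)
  have hac := push_ac hφ hbm hbl hb1
  have htl' := ae_of_ae_map hbm.aemeasurable (hac.ae_le htl)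
  have ht1' := ae_of_ae_map hbm.aemeasurable (hac.ae_le ht1)
  have hev : ∀ᶠ r : ℝ in 𝓝[<] 1, r ∈ Ico (0:ℝ) 1 := Ico_mem_nhdsLT (by norm_num)
  have ip : Integrable p circleHaar := Integrable.of_bound hpm.aestronglyMeasurable 1 hp1
  have it : Integrable (fun ω => t (b ω)) circleHaar :=
    Integrable.of_bound (htm.comp hbm).aestronglyMeasurable 1 (by
      filter_upwards [ht1'] with ω hω using hω.le)
  have key : ∀ z ∈ ball (0:ℂ) 1, ∫ ζ, pk z ζ • t (b ζ) ∂circleHaar = ϑ (φ z) := by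
    intro z hz
    have h1 : ∀ ρ ∈ Ico (0:ℝ) 1, ∫ ζ, pk z ζ • ϑ (ρ • b ζ) ∂circleHaar = ϑ (ρ • φ z) := by
      intro ρ hρ
      have hm : MapsTo (fun z => ρ • φ z) (ball (0:ℂ) 1) (ball (0:ℂ) 1) :=
        fun w hw => smul_mem_ball hρ (ball_subset_closedBall (hφ.2.1 hw))
      refine poisson_bdd (F := fun z => ϑ (ρ • φ z)) (C := 1)
        (hϑ.1.comp (hφ.1.const_smul ρ) hm) (fun w hw => hbd hϑ.2.1 _ (hm hw)) ?_ hz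
      filter_upwards [hbl, hb1] with ω hω hω1
      have hc : ContinuousAt ϑ (ρ • b ω) := hϑ.1.continuousOn.continuousAt
        (isOpen_ball.mem_nhds (smul_mem_ball hρ (by simp [hω1])))
      exact hc.tendsto.comp (hω.const_smul ρ)
    have h2 : Tendsto (fun ρ : ℝ => ∫ ζ, pk z ζ • ϑ (ρ • b ζ) ∂circleHaar) (𝓝[<] 1)
        (𝓝 (∫ ζ, pk z ζ • t (b ζ) ∂circleHaar)) := by
      refine tendsto_integral_filter_of_dominated_convergence (fun ζ => pk z ζ) ?_ ?_
        (pk_integrable hz) ?_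
      · filter_upwards [hev] with ρ hρ
        refine ((pk_measurable z).aestronglyMeasurable).smul ?_
        have hmm : Measurable ((closedBall (0:ℂ) 1).indicator fun w : ℂ => ϑ (ρ • w)) := by
          classical
          have := (radial_contOn hϑ.1 hρ).measurable_piecewise (g := (0 : ℂ → ℂ))
            continuousOn_const isClosed_closedBall.measurableSet
          rw [← piecewise_eq_indicator]
          exact this
        refine AEStronglyMeasurable.congr (hmm.comp hbm).aestronglyMeasurable ?_
        filter_upwards [hb1] with ω hω
        simp [hω]
      · filter_upwards [hev] with ρ hρ
        filter_upwards [hb1] with ω hω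
        rw [norm_smul, Real.norm_of_nonneg (pk_nonneg hz ω)]
        exact mul_le_of_le_one_right (pk_nonneg hz ω)
          (hbd hϑ.2.1 _ (smul_mem_ball hρ (by simp [hω])))
      · filter_upwards [htl'] with ω hω
        exact hω.const_smul _
    have h3 : Tendsto (fun ρ : ℝ => ϑ (ρ • φ z)) (𝓝[<] 1) (𝓝 (ϑ (φ z))) := by
      have hc : ContinuousAt ϑ (φ z) :=
        hϑ.1.continuousOn.continuousAt (isOpen_ball.mem_nhds (hφ.2.1 hz))
      have : ContinuousAt (fun r : ℝ => ϑ (r • φ z)) 1 := by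
        refine ContinuousAt.comp (g := ϑ) (by simpa using hc) (by fun_prop)
      have := this.tendsto.mono_left (nhdsWithin_le_nhds (s := Iio (1:ℝ)))
      simpa using this
    refine tendsto_nhds_unique h2 (h3.congr' ?_)
    filter_upwards [hev] with ρ hρ using (h1 ρ hρ).symm
  have hIntg : ∀ z ∈ ball (0:ℂ) 1, ∀ f : ℂ → ℂ, Integrable f circleHaar →
      Integrable (fun ζ => pk z ζ • f ζ) circleHaar := by
    intro z hz f hf
    obtain ⟨C, hC⟩ := (isCompact_sphere (0:ℂ) 1).exists_bound_of_continuousOn (pk_cont hz)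
    refine hf.bdd_smul C (contOn_aesm circleHaar_compl (pk_cont hz)) ?_
    filter_upwards [circleHaar_sphere] with ζ hζ using hC ζ hζ
  have hz := pk_unique_zero (ip.sub it) fun z hz => by
    simp only [Pi.sub_apply, smul_sub]
    rw [integral_sub (hIntg z hz _ ip) (hIntg z hz _ it), key z hz,
      poisson_bdd hd (hbd hmap) hpl hz, sub_self]
  filter_upwards [hz, ht1', hpl] with ω h1 h2 h3
  have h4 : p ω = t (b ω) := sub_eq_zero.1 h1
  have := h3.norm
  rwa [h4, h2] at this

lemma clark_pk {f : ℂ → ℂ} {α : ℂ} {ν : Measure ℂ} (h : IsClarkMeasure f α ν) {z : ℂ}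
    (hz : z ∈ ball (0:ℂ) 1) : ∫ ζ, pk z ζ ∂ν = pk (f z) α := h.2.2 z hz

lemma clark_mass {f : ℂ → ℂ} {α : ℂ} {ν : Measure ℂ} (h : IsClarkMeasure f α ν) :
    ν.real univ = pk (f 0) α := by
  have := h.1
  rw [← clark_pk h (by simp : (0:ℂ) ∈ ball (0:ℂ) 1)]
  have : ∫ ζ, pk 0 ζ ∂ν = ∫ ζ, (1:ℝ) ∂ν := by
    refine integral_congr_ae ?_
    filter_upwards [ae_sphere h.2.1] with ζ hζ
    have : ‖ζ‖ = 1 := by simpa using hζ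
    simp [pk, this]
  rw [this]; simp

lemma clark_disint
    (φ ϑ : ℂ → ℂ) (hφ : IsInner φ)
    (μφ : ℂ → Measure ℂ) (hμφ : ∀ β ∈ sphere (0:ℂ) 1, IsClarkMeasure φ β (μφ β))
    {α : ℂ} {ν κ : Measure ℂ} (hν : IsClarkMeasure ϑ α ν)
    (hκ : IsClarkMeasure (fun z => ϑ (φ z)) α κ) {h : ℂ → ℝ} (hh : Continuous h) :
    (∫ ζ, h ζ ∂κ) = ∫ β, (∫ ζ, h ζ ∂μφ β) ∂ν := by
  have := hν.1
  have := hκ.1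
  have hs : ∀ g ∈ pkSpan, ContinuousOn (fun β => ∫ ζ, g ζ ∂μφ β) (sphere (0:ℂ) 1) ∧
      (∫ ζ, g ζ ∂κ) = ∫ β, (∫ ζ, g ζ ∂μφ β) ∂ν := by
    intro g hg
    refine Submodule.span_induction (p := fun g _ =>
      ContinuousOn (fun β => ∫ ζ, g ζ ∂μφ β) (sphere (0:ℂ) 1) ∧
      (∫ ζ, g ζ ∂κ) = ∫ β, (∫ ζ, g ζ ∂μφ β) ∂ν) ?_ ?_ ?_ ?_ hg
    · rintro _ ⟨z, hz, rfl⟩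
      have e : EqOn (fun β => ∫ ζ, pk z ζ ∂μφ β) (pk (φ z)) (sphere (0:ℂ) 1) :=
        fun β hβ => clark_pk (hμφ β hβ) hz
      refine ⟨(pk_cont (hφ.2.1 hz)).congr e, ?_⟩
      rw [clark_pk hκ hz, ← clark_pk hν (hφ.2.1 hz)]
      refine integral_congr_ae ?_
      filter_upwards [ae_sphere hν.2.1] with β hβ using (e hβ).symm
    · simp [continuousOn_const]
    · rintro x y hx hy ⟨cx, ex⟩ ⟨cy, ey⟩
      have e : EqOn (fun β => ∫ ζ, (x + y) ζ ∂μφ β)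
          (fun β => (∫ ζ, x ζ ∂μφ β) + ∫ ζ, y ζ ∂μφ β) (sphere (0:ℂ) 1) := by
        intro β hβ
        have := (hμφ β hβ).1
        exact integral_add (contOn_integrable (hμφ β hβ).2.1 (pkSpan_cont hx))
          (contOn_integrable (hμφ β hβ).2.1 (pkSpan_cont hy))
      refine ⟨(cx.add cy).congr e, ?_⟩
      have e1 : (∫ ζ, (x + y) ζ ∂κ) = (∫ ζ, x ζ ∂κ) + ∫ ζ, y ζ ∂κ :=
        integral_add (contOn_integrable hκ.2.1 (pkSpan_cont hx))
          (contOn_integrable hκ.2.1 (pkSpan_cont hy))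
      rw [e1, ex, ey, ← integral_add (contOn_integrable hν.2.1 cx) (contOn_integrable hν.2.1 cy)]
      refine integral_congr_ae ?_
      filter_upwards [ae_sphere hν.2.1] with β hβ using (e hβ).symm
    · rintro a x hx ⟨cx, ex⟩
      simp only [Pi.smul_apply, integral_smul]
      exact ⟨cx.const_smul a, by rw [ex]⟩
  have h0 : (0:ℂ) ∈ ball (0:ℂ) 1 := by simp
  obtain ⟨B, hB⟩ := (isCompact_sphere (0:ℂ) 1).exists_bound_of_continuousOn
    (pk_cont (hφ.2.1 h0))
  have hB0 : 0 ≤ B := (norm_nonneg _).trans (hB 1 (by simp))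
  have happ : ∀ ε > 0, ∃ g ∈ pkSpan, (∀ ζ ∈ sphere (0:ℂ) 1, |h ζ - g ζ| ≤ ε) ∧
      ∀ β ∈ sphere (0:ℂ) 1, |(∫ ζ, h ζ ∂μφ β) - ∫ ζ, g ζ ∂μφ β| ≤ ε * B := by
    intro ε hε
    obtain ⟨g, hg, hfg⟩ := pk_dense hh hε
    refine ⟨g, hg, hfg, fun β hβ => ?_⟩
    have := (hμφ β hβ).1
    refine (integral_approx (hμφ β hβ).2.1 hh.continuousOn (pkSpan_cont hg) hfg).trans ?_
    gcongr
    rw [clark_mass (hμφ β hβ)]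
    exact (le_abs_self _).trans (hB β hβ)
  have hcont : ContinuousOn (fun β => ∫ ζ, h ζ ∂μφ β) (sphere (0:ℂ) 1) := by
    refine continuousOn_of_uniform_approx_of_continuousOn fun u hu => ?_
    obtain ⟨ε, hε, hεu⟩ := Metric.mem_uniformity_dist.1 hu
    obtain ⟨g, hg, -, h2⟩ := happ (ε / (2 * (B + 1))) (by positivity)
    refine ⟨_, (hs g hg).1, fun β hβ => hεu ?_⟩
    rw [Real.dist_eq]
    refine (h2 β hβ).trans_lt ?_
    rw [div_mul_eq_mul_div, div_lt_iff₀ (by positivity)]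
    nlinarith
  rw [← sub_eq_zero, ← abs_nonpos_iff]
  refine eq_of_forall_eps (C := κ.real univ + B * ν.real univ) fun ε hε => ?_
  obtain ⟨g, hg, h1, h2⟩ := happ ε hε
  have a1 := integral_approx hκ.2.1 hh.continuousOn (pkSpan_cont hg) h1
  have a2 := integral_approx hν.2.1 hcont (hs g hg).1 h2
  rw [(hs g hg).2] at a1
  rw [abs_sub_comm] at a2
  have h3 := abs_sub_le (∫ ζ, h ζ ∂κ) (∫ β, (∫ ζ, g ζ ∂μφ β) ∂ν) (∫ β, (∫ ζ, h ζ ∂μφ β) ∂ν)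
  linarith

/-- if `φ, ϑ` are inner with `ϑ(0) = 0`, then `ψ = ϑ ∘ φ` is inner
and its Clark measures disintegrate as `μ_α^ψ = ∫_𝕋 μ_β^φ dμ_α^ϑ(β)`, tested
against continuous functions on the circle. -/
theorem clark_measure_of_composition
    (φ ϑ : ℂ → ℂ) (hφ : IsInner φ) (hϑ : IsInner ϑ) (hϑ0 : ϑ 0 = 0)
    (μφ : ℂ → Measure ℂ) (hμφ : ∀ β ∈ sphere (0:ℂ) 1, IsClarkMeasure φ β (μφ β))
    (μϑ : ℂ → Measure ℂ) (hμϑ : ∀ α ∈ sphere (0:ℂ) 1, IsClarkMeasure ϑ α (μϑ α))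
    (μψ : ℂ → Measure ℂ)
    (hμψ : ∀ α ∈ sphere (0:ℂ) 1, IsClarkMeasure (fun z => ϑ (φ z)) α (μψ α)) :
    IsInner (fun z => ϑ (φ z)) ∧
    ∀ α ∈ sphere (0:ℂ) 1, ∀ h : ℂ → ℝ, Continuous h →
      (∫ ζ, h ζ ∂μψ α) = ∫ β, (∫ ζ, h ζ ∂μφ β) ∂μϑ α := by
  exact ⟨inner_comp hφ hϑ, fun α hα h hh =>
    clark_disint φ ϑ hφ μφ hμφ (hμϑ α hα) (hμψ α hα) hh⟩
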